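/- Let (W,S) be a finitely generated Coxeter system with Cayley graph Λ(W,S). Suppose β is an edge path in Λ connecting vertices a and b such that each vertex of β lies on some geodesic edge path connecting a and b. Then: (i) each edge of β belongs to a wall that separates a from b; (ii) each wall crossed by β is crossed an odd number of times by β; and (iii) if c and d are vertices of β, then any wall separating c and d also separates a and b. -/

import Mathlib

/-!
Common definitions: Cayley graph of a Coxeter system, walls, sides,
bracket numbers, edge paths, quasi-geodesics, tracking.
-/

namespace CoxTrack

variable {B : Type*} {W : Type*} [Group W] {M : CoxeterMatrix B}

/-- The word metric on the Cayley graph `Λ(W,S)`: `d u v = ℓ(u⁻¹ v)`. -/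
noncomputable def d (cs : CoxeterSystem M W) (u v : W) : ℕ := cs.length (u⁻¹ * v)

/-- `u` and `v` are adjacent vertices (endpoints of a common edge) of `Λ(W,S)`. -/
def Adj (cs : CoxeterSystem M W) (u v : W) : Prop := ∃ i : B, v = u * cs.simple i

/-- The edge with endpoints `u` and `v` belongs to the wall of the reflection `t`
(i.e. `t` fixes this edge setwise, interchanging its endpoints). -/
def EdgeInWall (cs : CoxeterSystem M W) (t u v : W) : Prop :=
  Adj cs u v ∧ t * u = v

/-- `v` is a vertex of `Q̄`, the union of the edges of the wall of the reflection `t`. -/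
def InWallBar (cs : CoxeterSystem M W) (t v : W) : Prop :=
  ∃ i : B, t * v = v * cs.simple i

/-- Vertices `u` and `v` lie on the same side of the wall of the reflection `t`. -/
def SameSide (cs : CoxeterSystem M W) (t u v : W) : Prop :=
  (cs.length (t * u) < cs.length u ↔ cs.length (t * v) < cs.length v)

/-- The wall of the reflection `t` separates the vertices `u` and `v`. -/
def SeparatesPts (cs : CoxeterSystem M W) (t u v : W) : Prop := ¬ SameSide cs t u v

/-- The walls of the reflections `t` and `t'` are parallel: they are distinct and
all edges of each one lie on one side of the other. -/
def Parallel (cs : CoxeterSystem M W) (t t' : W) : Prop :=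
  t ≠ t' ∧ (∀ u v, InWallBar cs t' u → InWallBar cs t' v → SameSide cs t u v)
         ∧ (∀ u v, InWallBar cs t u → InWallBar cs t v → SameSide cs t' u v)

/-- The walls of the reflections `t` and `t'` cross (they are distinct and not parallel). -/
def Crosses (cs : CoxeterSystem M W) (t t' : W) : Prop := t ≠ t' ∧ ¬ Parallel cs t t'

/-- The wall of the reflection `r` separates `Q̄` (for the wall of the reflection `t`)
from the vertex `p`. -/
def SepWallFromPt (cs : CoxeterSystem M W) (r t p : W) : Prop :=
  ∀ v, InWallBar cs t v → SeparatesPts cs r v p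

/-- The distance from the vertex `p` to `Q̄` (the wall of the reflection `t`),
measured to the nearest vertex of `Q̄`. -/
noncomputable def wallDist (cs : CoxeterSystem M W) (t p : W) : ℕ :=
  sInf {n : ℕ | ∃ v, InWallBar cs t v ∧ d cs p v = n}

/-- `v 0, v 1, …, v n` are the consecutive vertices of an edge path of length `n` in `Λ(W,S)`. -/
def IsPath (cs : CoxeterSystem M W) (v : ℕ → W) (n : ℕ) : Prop :=
  ∀ k, k < n → Adj cs (v k) (v (k+1))

/-- `v 0, …, v n` are the consecutive vertices of a geodesic edge path of length `n`. -/
def IsGeodesic (cs : CoxeterSystem M W) (v : ℕ → W) (n : ℕ) : Prop :=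
  IsPath cs v n ∧ d cs (v 0) (v n) = n

/-- `v 0, v 1, …` are the consecutive vertices of an edge path ray. -/
def IsRay (cs : CoxeterSystem M W) (v : ℕ → W) : Prop := ∀ k, Adj cs (v k) (v (k+1))

/-- A geodesic edge path ray. -/
def IsGeodesicRay (cs : CoxeterSystem M W) (v : ℕ → W) : Prop :=
  IsRay cs v ∧ ∀ j k, j ≤ k → d cs (v j) (v k) = k - j

/-- `…, v (-1), v 0, v 1, …` are the consecutive vertices of an edge path line. -/
def IsLine (cs : CoxeterSystem M W) (v : ℤ → W) : Prop := ∀ k : ℤ, Adj cs (v k) (v (k+1))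

/-- A geodesic edge path line. -/
def IsGeodesicLine (cs : CoxeterSystem M W) (v : ℤ → W) : Prop :=
  IsLine cs v ∧ ∀ j k : ℤ, j ≤ k → (d cs (v j) (v k) : ℤ) = k - j

/-- The set of (reflections of) walls bracketing the vertex `v k` of the edge path
`v 0, …, v n`: walls containing an edge of the path before `v k` and an edge after `v k`. -/
def Brackets (cs : CoxeterSystem M W) (v : ℕ → W) (n k : ℕ) : Set W :=
  {t | ∃ j m, j < k ∧ k ≤ m ∧ m < n ∧
      EdgeInWall cs t (v j) (v (j+1)) ∧ EdgeInWall cs t (v m) (v (m+1))}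

/-- The set of walls bracketing the vertex `v k` of the edge path ray `v`. -/
def BracketsRay (cs : CoxeterSystem M W) (v : ℕ → W) (k : ℕ) : Set W :=
  {t | ∃ j m, j < k ∧ k ≤ m ∧
      EdgeInWall cs t (v j) (v (j+1)) ∧ EdgeInWall cs t (v m) (v (m+1))}

/-- The set of walls bracketing the vertex `v k` of the edge path line `v`. -/
def BracketsLine (cs : CoxeterSystem M W) (v : ℤ → W) (k : ℤ) : Set W :=
  {t | ∃ j m : ℤ, j < k ∧ k ≤ m ∧
      EdgeInWall cs t (v j) (v (j+1)) ∧ EdgeInWall cs t (v m) (v (m+1))}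

/-- The edge path `v 0, …, v n` is a `(lam, eps)`-quasi-geodesic. -/
def IsQG (cs : CoxeterSystem M W) (lam eps : ℝ) (v : ℕ → W) (n : ℕ) : Prop :=
  IsPath cs v n ∧ ∀ j k, j ≤ n → k ≤ n →
    |(j : ℝ) - (k : ℝ)| ≤ lam * (d cs (v j) (v k) : ℝ) + eps

/-- The edge path ray `v` is a `(lam, eps)`-quasi-geodesic. -/
def IsQGRay (cs : CoxeterSystem M W) (lam eps : ℝ) (v : ℕ → W) : Prop :=
  IsRay cs v ∧ ∀ j k : ℕ, |(j : ℝ) - (k : ℝ)| ≤ lam * (d cs (v j) (v k) : ℝ) + eps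

/-- The edge path line `v` is a `(lam, eps)`-quasi-geodesic. -/
def IsQGLine (cs : CoxeterSystem M W) (lam eps : ℝ) (v : ℤ → W) : Prop :=
  IsLine cs v ∧ ∀ j k : ℤ, |(j : ℝ) - (k : ℝ)| ≤ lam * (d cs (v j) (v k) : ℝ) + eps

/-- `P` is a Parallel Wall function for `(W,S)`: for each positive integer `n`, every wall `Q`
and every vertex `p` at distance at least `P n` from `Q̄`, there are `n` distinct pairwise
parallel walls separating `Q̄` from `p`. -/
def IsParallelWallFn (cs : CoxeterSystem M W) (P : ℕ → ℕ) : Prop :=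
  ∀ n : ℕ, 0 < n → ∀ t p : W, cs.IsReflection t → P n ≤ wallDist cs t p →
    ∃ T : Finset W, T.card = n ∧ (∀ r ∈ T, cs.IsReflection r) ∧
      (∀ r ∈ T, ∀ r' ∈ T, r ≠ r' → Parallel cs r r') ∧
      (∀ r ∈ T, SepWallFromPt cs r t p)

/-- `w 0, …, w m` (with distinguished approximation vertices `w (c 0), …, w (c n)`)
is an `L`-approximation of the edge path `v 0, …, v n`: it is an edge path with the
same endpoints, the segment from `w (c i)` to `w (c (i+1))` is geodesic, and the
approximation vertex `w (c i)` is within `L` of `v i`. -/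
def IsApprox (cs : CoxeterSystem M W) (L : ℕ) (v : ℕ → W) (n : ℕ)
    (w : ℕ → W) (m : ℕ) (c : ℕ → ℕ) : Prop :=
  IsPath cs w m ∧ c 0 = 0 ∧ c n = m ∧ (∀ i, i < n → c i ≤ c (i+1)) ∧
  w 0 = v 0 ∧ w m = v n ∧
  (∀ i, i ≤ n → d cs (w (c i)) (v i) ≤ L) ∧
  (∀ i, i < n → d cs (w (c i)) (w (c (i+1))) = c (i+1) - c i)

/-- The action of the simple reflection `s i` on `W × ZMod 2`: conjugation on the first
coordinate, and a flip of the second one exactly when the first is `s i`. -/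
noncomputable def simplePerm (cs : CoxeterSystem M W) (i : B) : Equiv.Perm (W × ZMod 2) :=
  open Classical in
  Function.Involutive.toPerm
    (fun p => (cs.simple i * p.1 * cs.simple i, p.2 + if p.1 = cs.simple i then 1 else 0)) <| by
    rintro ⟨t, z⟩
    have h : cs.simple i * t * cs.simple i = cs.simple i ↔ t = cs.simple i := by
      constructor
      · intro h
        have := congrArg (fun x => cs.simple i * x * cs.simple i) h
        simpa [mul_assoc] using this
      · rintro rfl
        simp
    ext
    · simp [mul_assoc]
    · by_cases ht : t = cs.simple i
      · simp [ht, add_assoc, CharTwo.add_self_eq_zero]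
      · simp [h, ht]

open Classical in
theorem simplePerm_apply (cs : CoxeterSystem M W) (i : B) (t : W) (z : ZMod 2) :
    simplePerm cs i (t, z) =
      (cs.simple i * t * cs.simple i, z + if t = cs.simple i then 1 else 0) := rfl

open Classical in
theorem simplePerm_mul_pow_apply (cs : CoxeterSystem M W) (i j : B) (n : ℕ) (t : W)
    (z : ZMod 2) :
    ((simplePerm cs i * simplePerm cs j) ^ n) (t, z) =
      ((cs.simple i * cs.simple j) ^ n * t * ((cs.simple i * cs.simple j) ^ n)⁻¹,
        z + ∑ l ∈ Finset.range (2 * n),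
          if t = cs.simple j * (cs.simple i * cs.simple j) ^ l then 1 else 0) := by
  induction n with
  | zero => simp
  | succ n ih =>
    set p := cs.simple i * cs.simple j with hp
    have hinv : p⁻¹ = cs.simple j * cs.simple i := by simp [hp]
    have hjp : cs.simple j * p * cs.simple j = p⁻¹ := by simp [hp, mul_assoc]
    have hjpn (k : ℕ) : cs.simple j * p ^ k = (p ^ k)⁻¹ * cs.simple j := by
      have : SemiconjBy (cs.simple j) p p⁻¹ := by
        rw [SemiconjBy, ← hjp]; simp [mul_assoc]
      simpa [SemiconjBy] using this.pow_right k
    have hshift (e : ℕ) : p ^ n * t * (p ^ n)⁻¹ = cs.simple j * p ^ e ↔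
        t = cs.simple j * p ^ (2 * n + e) := by
      have : cs.simple j * p ^ (2 * n + e) = (p ^ n)⁻¹ * (cs.simple j * p ^ e * p ^ n) := by
        rw [show 2 * n + e = n + (e + n) by ring, pow_add p n, ← mul_assoc, hjpn n, pow_add]
        simp only [mul_assoc]
      rw [this, mul_inv_eq_iff_eq_mul, eq_inv_mul_iff_mul_eq]
    have h₁ : p ^ n * t * (p ^ n)⁻¹ = cs.simple j ↔ t = cs.simple j * p ^ (2 * n) := by
      simpa using hshift 0
    have h₂ : cs.simple j * (p ^ n * t * (p ^ n)⁻¹) * cs.simple j = cs.simple i ↔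
        t = cs.simple j * p ^ (2 * n + 1) := by
      rw [← hshift 1, ← mul_left_cancel_iff (a := cs.simple j),
        ← mul_right_cancel_iff (a := cs.simple j)]
      simp [hp, mul_assoc]
    rw [pow_succ', Equiv.Perm.mul_apply, ih, Equiv.Perm.mul_apply, simplePerm_apply,
      simplePerm_apply, h₁, h₂, mul_add, Finset.sum_range_succ, Finset.sum_range_succ,
      pow_succ' p n, mul_inv_rev, hinv]
    ext
    · simp only [hp, mul_assoc]
    · simp [add_assoc]

theorem isLiftable_simplePerm (cs : CoxeterSystem M W) : M.IsLiftable (simplePerm cs) := by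
  classical
  intro i j
  ext1 ⟨t, z⟩
  rw [simplePerm_mul_pow_apply, cs.simple_mul_simple_pow, two_mul,
    Finset.sum_range_add]
  simp [pow_add, CharTwo.add_self_eq_zero]

/-- The reflection representation of `W` on `W × ZMod 2`. -/
noncomputable def reflectionPerm (cs : CoxeterSystem M W) : W →* Equiv.Perm (W × ZMod 2) :=
  cs.lift ⟨simplePerm cs, isLiftable_simplePerm cs⟩

/-- The parity of the number of occurrences of `t` in the right inversion sequence of any word
for `w`. -/
noncomputable def inversionParity (cs : CoxeterSystem M W) (w t : W) : ZMod 2 :=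
  (reflectionPerm cs w (t, 0)).2

theorem reflectionPerm_simple (cs : CoxeterSystem M W) (i : B) :
    reflectionPerm cs (cs.simple i) = simplePerm cs i :=
  cs.lift_apply_simple (isLiftable_simplePerm cs) i

open Classical in
theorem reflectionPerm_apply (cs : CoxeterSystem M W) (w t : W) (z : ZMod 2) :
    reflectionPerm cs w (t, z) = (w * t * w⁻¹, z + inversionParity cs w t) := by
  induction w using cs.simple_induction_left generalizing z with
  | one => simp [inversionParity]
  | mul_simple_left w i ih =>
    have h (z : ZMod 2) : reflectionPerm cs (cs.simple i * w) (t, z) =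
        (cs.simple i * (w * t * w⁻¹) * cs.simple i, z + inversionParity cs w t +
          if w * t * w⁻¹ = cs.simple i then 1 else 0) := by
      rw [map_mul, Equiv.Perm.mul_apply, ih, reflectionPerm_simple, simplePerm_apply]
    rw [inversionParity, h, h]
    simp [mul_assoc, add_assoc]

theorem inversionParity_mul (cs : CoxeterSystem M W) (u v t : W) :
    inversionParity cs (u * v) t =
      inversionParity cs v t + inversionParity cs u (v * t * v⁻¹) := by
  have := reflectionPerm_apply cs (u * v) t 0
  rw [map_mul, Equiv.Perm.mul_apply, reflectionPerm_apply, reflectionPerm_apply] at this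
  simpa using (congrArg Prod.snd this).symm

theorem inversionParity_one (cs : CoxeterSystem M W) (t : W) : inversionParity cs 1 t = 0 := by
  simp [inversionParity]

open Classical in
theorem inversionParity_simple (cs : CoxeterSystem M W) (i : B) (t : W) :
    inversionParity cs (cs.simple i) t = if t = cs.simple i then 1 else 0 := by
  simp [inversionParity, reflectionPerm_simple, simplePerm_apply]

theorem inversionParity_self (cs : CoxeterSystem M W) {t : W} (ht : cs.IsReflection t) :
    inversionParity cs t t = 1 := by
  obtain ⟨u, i, rfl⟩ := ht
  have h := inversionParity_mul cs u u⁻¹ (u * cs.simple i * u⁻¹)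
  have e : u⁻¹ * (u * cs.simple i * u⁻¹) * u⁻¹⁻¹ = cs.simple i := by group
  rw [mul_inv_cancel, inversionParity_one, e] at h
  rw [inversionParity_mul cs (u * cs.simple i) u⁻¹, e, inversionParity_mul cs u,
    inversionParity_simple, if_pos rfl, mul_inv_cancel_right, add_left_comm, ← h, add_zero]

theorem mem_rightInvSeq_of_inversionParity_ne_zero (cs : CoxeterSystem M W) (ω : List B) (t : W)
    (h : inversionParity cs (cs.wordProd ω) t ≠ 0) : t ∈ cs.rightInvSeq ω := by
  induction ω with
  | nil => simp [inversionParity_one] at h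
  | cons i ω ih =>
    rw [cs.wordProd_cons, inversionParity_mul, inversionParity_simple] at h
    rw [CoxeterSystem.rightInvSeq, List.mem_cons]
    by_cases h₀ : inversionParity cs (cs.wordProd ω) t = 0
    · left
      by_contra hne
      refine h ?_
      rw [h₀, if_neg, add_zero]
      intro h'
      exact hne (by rw [← h']; group)
    · exact Or.inr (ih h₀)

theorem length_mul_lt_of_inversionParity_ne_zero (cs : CoxeterSystem M W) {w t : W}
    (h : inversionParity cs w t ≠ 0) : cs.length (w * t) < cs.length w := by
  obtain ⟨ω, hω, rfl⟩ := cs.exists_isReduced w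
  exact (cs.isRightInversion_of_mem_rightInvSeq hω
    (mem_rightInvSeq_of_inversionParity_ne_zero cs ω t h)).2

theorem length_mul_lt_iff (cs : CoxeterSystem M W) {t : W} (ht : cs.IsReflection t) (w : W) :
    cs.length (w * t) < cs.length w ↔ inversionParity cs w t ≠ 0 := by
  refine ⟨fun hlt h => ?_, length_mul_lt_of_inversionParity_ne_zero cs⟩
  have h' : inversionParity cs (w * t) t ≠ 0 := by
    rw [inversionParity_mul, inversionParity_self cs ht, mul_inv_cancel_right, h]
    simp
  have := length_mul_lt_of_inversionParity_ne_zero cs h'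
  rw [mul_assoc, ht.mul_self, mul_one] at this
  exact lt_asymm hlt this

/-- The side of the wall of `t` on which the vertex `u` lies. -/
noncomputable def side (cs : CoxeterSystem M W) (t u : W) : ZMod 2 := inversionParity cs u⁻¹ t

theorem length_mul_left_lt_iff (cs : CoxeterSystem M W) {t : W} (ht : cs.IsReflection t)
    (u : W) : cs.length (t * u) < cs.length u ↔ side cs t u ≠ 0 := by
  rw [side, ← length_mul_lt_iff cs ht, ← cs.length_inv (t * u), ← cs.length_inv u, mul_inv_rev,
    ht.inv]

theorem sameSide_iff (cs : CoxeterSystem M W) {t : W} (ht : cs.IsReflection t) (u v : W) :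
    SameSide cs t u v ↔ side cs t u = side cs t v := by
  rw [SameSide, length_mul_left_lt_iff cs ht, length_mul_left_lt_iff cs ht, not_iff_not]
  generalize side cs t u = x
  generalize side cs t v = y
  revert x y
  decide

theorem side_mul (cs : CoxeterSystem M W) (t a u : W) :
    side cs t (a * u) = side cs t a + side cs (a⁻¹ * t * a) u := by
  simp [side, inversionParity_mul]

open Classical in
theorem side_of_adj (cs : CoxeterSystem M W) {u v : W} (h : Adj cs u v) (t : W) :
    side cs t v = side cs t u + if EdgeInWall cs t u v then 1 else 0 := by
  have hedge : EdgeInWall cs t u v ↔ t * u = v := and_iff_right h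
  obtain ⟨i, rfl⟩ := h
  rw [side_mul, side, side, cs.inv_simple, inversionParity_simple]
  simp only [hedge, mul_assoc, inv_mul_eq_iff_eq_mul]

theorem separatesPts_iff_d_lt (cs : CoxeterSystem M W) {t : W} (ht : cs.IsReflection t)
    (a x : W) : SeparatesPts cs t a x ↔ d cs (t * a) x < d cs a x := by
  have ht' : cs.IsReflection (a⁻¹ * t * a) := by simpa using ht.conj a⁻¹
  have h := side_mul cs t a (a⁻¹ * x)
  rw [mul_inv_cancel_left] at h
  have e : (t * a)⁻¹ * x = a⁻¹ * t * a * (a⁻¹ * x) := by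
    rw [mul_inv_rev, ht.inv]; group
  rw [SeparatesPts, sameSide_iff cs ht, d, d, e, length_mul_left_lt_iff cs ht', h]
  simp

theorem d_triangle (cs : CoxeterSystem M W) (a x b : W) : d cs a b ≤ d cs a x + d cs x b := by
  simpa [d, mul_assoc] using cs.length_mul_le (a⁻¹ * x) (x⁻¹ * b)

/-- A wall separating an endpoint of a geodesic from one of its vertices separates the
endpoints. -/
theorem SeparatesPts.of_d_add (cs : CoxeterSystem M W) {t : W} (ht : cs.IsReflection t)
    {a x b : W} (h : d cs a x + d cs x b = d cs a b) (hs : SeparatesPts cs t a x) :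
    SeparatesPts cs t a b := by
  rw [separatesPts_iff_d_lt cs ht] at hs ⊢
  have := d_triangle cs (t * a) x b
  omega

open Classical in
/-- An edge path changes sides of a wall once for every crossing. -/
theorem side_path (cs : CoxeterSystem M W) {w : ℕ → W} {m : ℕ} (hpath : IsPath cs w m) (t : W) :
    side cs t (w m) = side cs t (w 0) +
      ({k | k < m ∧ EdgeInWall cs t (w k) (w (k + 1))}.ncard : ZMod 2) := by
  have hset : {k | k < m ∧ EdgeInWall cs t (w k) (w (k + 1))} =
      ((Finset.range m).filter fun k => EdgeInWall cs t (w k) (w (k + 1)) : Finset ℕ) := by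
    ext; simp
  rw [hset, Set.ncard_coe_finset, ← Finset.sum_boole]
  clear hset
  induction m with
  | zero => simp
  | succ m ih =>
    rw [side_of_adj cs (hpath m m.lt_succ_self), ih fun k hk => hpath k (hk.trans m.lt_succ_self),
      Finset.sum_range_succ, add_assoc]

theorem separatesPts_of_edgeInWall (cs : CoxeterSystem M W) {t u v : W}
    (ht : cs.IsReflection t) (h : EdgeInWall cs t u v) : SeparatesPts cs t u v := by
  rw [SeparatesPts, sameSide_iff cs ht, side_of_adj cs h.1, if_pos h]
  simp

/-- Suppose `β = w 0, …, w m` is an edge path from `a` to `b` each of whose vertices lies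
on a geodesic connecting `a` and `b`. Then (i) each edge of `β` belongs to a wall
separating `a` from `b`; (ii) each wall crossed by `β` is crossed an odd number of times;
(iii) any wall separating two vertices of `β` separates `a` and `b`. -/
theorem easy_lemma {B : Type*} {W : Type*} [Group W] [Finite B]
    {M : CoxeterMatrix B} (cs : CoxeterSystem M W)
    (w : ℕ → W) (m : ℕ) (hpath : IsPath cs w m)
    (hongeo : ∀ k, k ≤ m → d cs (w 0) (w k) + d cs (w k) (w m) = d cs (w 0) (w m)) :
    (∀ k, k < m → ∃ t : W, cs.IsReflection t ∧ EdgeInWall cs t (w k) (w (k+1)) ∧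
        SeparatesPts cs t (w 0) (w m)) ∧
    (∀ t : W, cs.IsReflection t → (∃ k, k < m ∧ EdgeInWall cs t (w k) (w (k+1))) →
        Odd ({k | k < m ∧ EdgeInWall cs t (w k) (w (k+1))}.ncard)) ∧
    (∀ j k, j ≤ m → k ≤ m → ∀ t : W, cs.IsReflection t →
        SeparatesPts cs t (w j) (w k) → SeparatesPts cs t (w 0) (w m)) := by
  have hsep : ∀ j k, j ≤ m → k ≤ m → ∀ t : W, cs.IsReflection t →
      SeparatesPts cs t (w j) (w k) → SeparatesPts cs t (w 0) (w m) := by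
    intro j k hj hk t ht hs
    by_cases h : SameSide cs t (w 0) (w j)
    · refine SeparatesPts.of_d_add cs ht (hongeo k hk) fun h' => hs ?_
      exact h.symm.trans h'
    · exact SeparatesPts.of_d_add cs ht (hongeo j hj) h
  refine ⟨fun k hk => ?_, ?_, hsep⟩
  · obtain ⟨i, hi⟩ := hpath k hk
    have ht : cs.IsReflection (w k * cs.simple i * (w k)⁻¹) := ⟨w k, i, rfl⟩
    have he : EdgeInWall cs (w k * cs.simple i * (w k)⁻¹) (w k) (w (k + 1)) :=
      ⟨⟨i, hi⟩, by rw [hi, inv_mul_cancel_right]⟩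
    exact ⟨_, ht, he, hsep k (k + 1) hk.le hk _ ht (separatesPts_of_edgeInWall cs ht he)⟩
  · rintro t ht ⟨k, hk, he⟩
    have h := hsep k (k + 1) hk.le hk t ht (separatesPts_of_edgeInWall cs ht he)
    rw [SeparatesPts, sameSide_iff cs ht, side_path cs hpath, left_eq_add] at h
    rwa [← Nat.not_even_iff_odd, ← ZMod.natCast_eq_zero_iff_even]

end CoxTrack
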